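/- In the setting of the abstract two-level estimate with u ∈ V the primal solution (B(u, v) = F(v) for all v ∈ V), the estimator μ controls the energy error reduction achieved by passing from W to Ŵ: (λ/K)·μ² ≤ |||u − u_W|||² − |||u − û|||² ≤ Λ·C·μ², where |||v||| := B(v,v)^{1/2}. -/

import Mathlib

/-- Lax–Milgram on a closed subspace: a bounded coercive bilinear form represents every
bounded linear functional on a closed subspace. -/
theorem exists_mem_forall_bilin_eq_of_coercive
    {V : Type*} [NormedAddCommGroup V] [InnerProductSpace ℝ V] [CompleteSpace V]
    (A : V →ₗ[ℝ] V →ₗ[ℝ] ℝ)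
    (hbdd : ∃ M : ℝ, ∀ v w : V, |A v w| ≤ M * ‖v‖ * ‖w‖)
    (hcoer : ∃ c : ℝ, 0 < c ∧ ∀ v : V, c * ‖v‖ ^ 2 ≤ A v v)
    (S : Submodule ℝ V) (hS : IsClosed (S : Set V)) (f : V →L[ℝ] ℝ) :
    ∃ x ∈ S, ∀ w ∈ S, A x w = f w := by
  obtain ⟨M, hM⟩ := hbdd
  obtain ⟨c, hc, hcA⟩ := hcoer
  have : CompleteSpace S := hS.completeSpace_coe
  let T : S →L[ℝ] S →L[ℝ] ℝ := LinearMap.mkContinuous₂ (A.domRestrict₁₂ S S) M fun v w => hM v w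
  have hT : IsCoercive T := ⟨c, hc, fun v => by
    have := hcA v
    rwa [pow_two, ← mul_assoc] at this⟩
  let g : S := (InnerProductSpace.toDual ℝ S).symm (f.comp S.subtypeL)
  refine ⟨hT.continuousLinearEquivOfBilin.symm g, Submodule.coe_mem _, fun w hw => ?_⟩
  have h := hT.continuousLinearEquivOfBilin_apply (hT.continuousLinearEquivOfBilin.symm g) ⟨w, hw⟩
  rw [ContinuousLinearEquiv.apply_symm_apply, InnerProductSpace.toDual_symm_apply] at h
  exact h.symm

/-- If `B₀` is bounded below by `lam` times `B`, then the `B₀`-representative `x` of the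
functional `B d` satisfies `lam * B₀ x x ≤ B d d`. -/
theorem mul_bilin_self_le_of_representative
    {V : Type*} [AddCommGroup V] [Module ℝ V] (B B₀ : V →ₗ[ℝ] V →ₗ[ℝ] ℝ)
    (hBsymm : ∀ v w : V, B v w = B w v) (hBnonneg : ∀ v : V, 0 ≤ B v v)
    (lam : ℝ) (hlam : 0 < lam) (d x : V) (hx : lam * B x x ≤ B₀ x x) (hrep : B₀ x x = B d x) :
    lam * B₀ x x ≤ B d d := by
  have h := hBnonneg (d - lam • x)
  simp only [map_sub, map_smul, LinearMap.sub_apply, LinearMap.smul_apply, smul_eq_mul,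
    hBsymm x d] at h
  nlinarith [mul_le_mul_of_nonneg_left hx hlam.le]

/-- If `B₀` is bounded above by `Lam` times `B`, then the `B₀`-representative `x` of the
functional `B d` satisfies `B d d ≤ Lam * B₀ x x`. -/
theorem bilin_self_le_mul_of_representative
    {V : Type*} [AddCommGroup V] [Module ℝ V] (B B₀ : V →ₗ[ℝ] V →ₗ[ℝ] ℝ)
    (hB₀symm : ∀ v w : V, B₀ v w = B₀ w v) (hB₀nonneg : ∀ v : V, 0 ≤ B₀ v v)
    (Lam : ℝ) (hLam : 0 < Lam) (d x : V) (hd : B₀ d d ≤ Lam * B d d) (hrep : B₀ x d = B d d) :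
    B d d ≤ Lam * B₀ x x := by
  have h := hB₀nonneg (Lam • x - d)
  simp only [map_sub, map_smul, LinearMap.sub_apply, LinearMap.smul_apply, smul_eq_mul,
    hB₀symm d x, hrep] at h
  have : 0 ≤ Lam * (Lam * B₀ x x - B d d) := by linarith
  linarith [nonneg_of_mul_nonneg_right this hLam]


/-- The two-level estimator `μ` controls the energy error reduction achieved
by passing from `W` to `Ŵ` (estimate (4.5)):
`(λ/K)·μ² ≤ |||u − u_W|||² − |||u − û|||² ≤ Λ·C·μ²`, where
`|||v||| = B(v,v)^{1/2}`. Here `Wh` denotes `Ŵ` and `uh` denotes `û`. -/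
theorem twolevel_estimate_error_reduction
    {V : Type*} [NormedAddCommGroup V] [InnerProductSpace ℝ V] [CompleteSpace V]
    (B B₀ : V →ₗ[ℝ] V →ₗ[ℝ] ℝ)
    (hBsymm : ∀ v w : V, B v w = B w v)
    (hBbdd : ∃ M : ℝ, ∀ v w : V, |B v w| ≤ M * ‖v‖ * ‖w‖)
    (hBcoer : ∃ c : ℝ, 0 < c ∧ ∀ v : V, c * ‖v‖ ^ 2 ≤ B v v)
    (hB₀symm : ∀ v w : V, B₀ v w = B₀ w v)
    (hB₀bdd : ∃ M : ℝ, ∀ v w : V, |B₀ v w| ≤ M * ‖v‖ * ‖w‖)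
    (hB₀coer : ∃ c : ℝ, 0 < c ∧ ∀ v : V, c * ‖v‖ ^ 2 ≤ B₀ v v)
    (lam Lam : ℝ) (hlam : 0 < lam) (hLam : 0 < Lam)
    (hequiv : ∀ v : V, lam * B v v ≤ B₀ v v ∧ B₀ v v ≤ Lam * B v v)
    (F : V →L[ℝ] ℝ)
    (u : V) (hu : ∀ v : V, B u v = F v)
    (W Wh : Submodule ℝ V) (hWWh : W ≤ Wh)
    (hW : IsClosed ((W : Set V))) (hWh : IsClosed ((Wh : Set V)))
    (uW : V) (huWmem : uW ∈ W) (huW : ∀ w ∈ W, B uW w = F w)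
    (uh : V) (huhmem : uh ∈ Wh) (huh : ∀ w ∈ Wh, B uh w = F w)
    (m : ℕ) (U : Fin m → Submodule ℝ V)
    (hUc : ∀ j, IsClosed ((U j : Set V))) (hUWh : ∀ j, U j ≤ Wh)
    (G : Fin m → V → V)
    (hGmem : ∀ j v, G j v ∈ U j)
    (hGorth : ∀ j v, ∀ w ∈ U j, B₀ (v - G j v) w = 0)
    (C K : ℝ) (hC : 1 ≤ C) (hK : 1 ≤ K)
    (hframe : ∀ vh ∈ Wh, (∀ w ∈ W, B₀ vh w = 0) →
      C⁻¹ * B₀ vh vh ≤ ∑ j, B₀ (G j vh) (G j vh) ∧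
        ∑ j, B₀ (G j vh) (G j vh) ≤ K * B₀ vh vh)
    (e : Fin m → V) (hemem : ∀ j, e j ∈ U j)
    (he : ∀ j, ∀ w ∈ U j, B₀ (e j) w = F w - B uW w)
    (μsq : ℝ) (hμsq : μsq = ∑ j, B₀ (e j) (e j)) :
    lam / K * μsq ≤
        Real.sqrt (B (u - uW) (u - uW)) ^ 2 - Real.sqrt (B (u - uh) (u - uh)) ^ 2 ∧
      Real.sqrt (B (u - uW) (u - uW)) ^ 2 - Real.sqrt (B (u - uh) (u - uh)) ^ 2 ≤
        Lam * C * μsq := by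
  have hBnonneg : ∀ v : V, 0 ≤ B v v := fun v => by
    obtain ⟨c, hc, h⟩ := hBcoer
    exact le_trans (by positivity) (h v)
  have hB₀nonneg : ∀ v : V, 0 ≤ B₀ v v := fun v => by
    obtain ⟨c, hc, h⟩ := hB₀coer
    exact le_trans (by positivity) (h v)
  have hB₀definite : ∀ v : V, B₀ v v = 0 → v = 0 := fun v hv => by
    obtain ⟨c, hc, h⟩ := hB₀coer
    have h1 : ‖v‖ ^ 2 ≤ 0 := nonpos_of_mul_nonpos_right (hv ▸ h v) hc
    exact norm_eq_zero.1 (pow_eq_zero_iff two_ne_zero |>.1 (le_antisymm h1 (sq_nonneg _)))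
  obtain ⟨M, hM⟩ := hBbdd
  obtain ⟨x, hxmem, hx⟩ := exists_mem_forall_bilin_eq_of_coercive B₀ hB₀bdd hB₀coer Wh hWh
    (F - (B uW).mkContinuous (M * ‖uW‖) (hM uW))
  replace hx : ∀ w ∈ Wh, B₀ x w = F w - B uW w := fun w hw => by simpa using hx w hw
  have hxd : ∀ w ∈ Wh, B₀ x w = B (uh - uW) w := fun w hw => by
    rw [hx w hw, map_sub, LinearMap.sub_apply, huh w hw]
  have hdmem : uh - uW ∈ Wh := Wh.sub_mem huhmem (hWWh huWmem)
  have hGe : ∀ j, G j x = e j := fun j => by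
    refine sub_eq_zero.1 (hB₀definite _ ?_)
    have hmem : G j x - e j ∈ U j := (U j).sub_mem (hGmem j x) (hemem j)
    have h1 := hGorth j x _ hmem
    have h2 := he j _ hmem
    rw [← hx _ (hUWh j hmem)] at h2
    rw [map_sub B₀, LinearMap.sub_apply] at h1 ⊢
    linarith
  obtain ⟨hlower, hupper⟩ := hframe x hxmem fun w hw => by
    rw [hx w (hWWh hw), huW w hw, sub_self]
  simp only [hGe, ← hμsq] at hlower hupper
  have hlamx := mul_bilin_self_le_of_representative B B₀ hBsymm hBnonneg lam hlam (uh - uW) x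
    (hequiv x).1 (hxd x hxmem)
  have hLamx := bilin_self_le_mul_of_representative B B₀ hB₀symm hB₀nonneg Lam hLam (uh - uW) x
    (hequiv _).2 (hxd _ hdmem)
  have hpyth : B (u - uW) (u - uW) - B (u - uh) (u - uh) = B (uh - uW) (uh - uW) := by
    have horth : B (u - uh) (uh - uW) = 0 := by
      rw [map_sub B, LinearMap.sub_apply, hu, huh _ hdmem, sub_self]
    have hsplit : u - uW = (u - uh) + (uh - uW) := by abel
    rw [hsplit]
    simp only [map_add, LinearMap.add_apply, hBsymm (uh - uW) (u - uh), horth]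
    ring
  rw [Real.sq_sqrt (hBnonneg _), Real.sq_sqrt (hBnonneg _), hpyth]
  have hK0 : 0 < K := by linarith
  have hC0 : 0 < C := by linarith
  constructor
  · refine le_trans ?_ hlamx
    rw [div_mul_eq_mul_div, div_le_iff₀ hK0, mul_assoc, mul_comm _ K]
    gcongr
  · refine hLamx.trans ?_
    rw [mul_assoc]
    gcongr
    exact (inv_mul_le_iff₀ hC0).1 hlower
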